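/- Under the stated limit assumptions, the quantity I_p = (p/u_p(s_p))·∫_{s_p}^1 s·u_p(s)^p ds converges to α + 2 as p → +∞ (in particular it is bounded). -/

import Mathlib

open Real MeasureTheory Set Filter

noncomputable section

/-- The radial energy functional for the Lane–Emden problem on the unit ball of `ℝ²`
(written in polar coordinates; the common factor `2π` is dropped). -/
def radialEnergy (p : ℝ) (v : ℝ → ℝ) : ℝ :=
  (1 / 2) * (∫ r in (0:ℝ)..1, (deriv v r) ^ 2 * r)
    - (1 / (p + 1)) * ∫ r in (0:ℝ)..1, |v r| ^ (p + 1) * r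

/-- The Nehari identity `∫_B |∇v⁺|² = ∫_B |v⁺|^{p+1}` for the positive part,
written in polar coordinates. -/
def nehariPos (p : ℝ) (v : ℝ → ℝ) : Prop :=
  (∫ r in (0:ℝ)..1, (if 0 < v r then (deriv v r) ^ 2 * r else 0))
    = ∫ r in (0:ℝ)..1, (max (v r) 0) ^ (p + 1) * r

/-- The Nehari identity `∫_B |∇v⁻|² = ∫_B |v⁻|^{p+1}` for the negative part,
written in polar coordinates. -/
def nehariNeg (p : ℝ) (v : ℝ → ℝ) : Prop :=
  (∫ r in (0:ℝ)..1, (if v r < 0 then (deriv v r) ^ 2 * r else 0))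
    = ∫ r in (0:ℝ)..1, (max (-v r) 0) ^ (p + 1) * r

/-- A family `p ↦ u p` (for `p > 1`) of least energy nodal radial solutions of the
Lane–Emden problem `−Δu = |u|^{p−1}u` in the unit ball `B ⊆ ℝ²`, `u = 0` on `∂B`,
described through the radial profile `u p : ℝ → ℝ`.  `rp p ∈ (0,1)` is the nodal
radius, `sp p ∈ (rp p, 1)` is a radius where `u p` attains `‖(u p)⁺‖_∞`; the solution
is negative in the inner nodal region (`u p 0 < 0`), attains `-‖(u p)⁻‖_∞` at `0`,
and minimizes the energy among radial members of the nodal Nehari set. -/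
structure LaneEmdenFamily where
  u : ℝ → ℝ → ℝ
  rp : ℝ → ℝ
  sp : ℝ → ℝ
  smooth : ∀ p, 1 < p → ContDiffOn ℝ 2 (u p) (Icc (0:ℝ) 1)
  ode : ∀ p, 1 < p → ∀ r ∈ Ioo (0:ℝ) 1,
    -deriv (deriv (u p)) r - deriv (u p) r / r = |u p r| ^ (p - 1) * u p r
  derivAtZero : ∀ p, 1 < p → deriv (u p) 0 = 0
  boundary : ∀ p, 1 < p → u p 1 = 0
  center_neg : ∀ p, 1 < p → u p 0 < 0
  min_at_zero : ∀ p, 1 < p → ∀ r ∈ Icc (0:ℝ) 1, u p 0 ≤ u p r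
  rp_mem : ∀ p, 1 < p → rp p ∈ Ioo (0:ℝ) 1
  rp_zero : ∀ p, 1 < p → u p (rp p) = 0
  neg_in : ∀ p, 1 < p → ∀ r ∈ Ico (0:ℝ) (rp p), u p r < 0
  pos_out : ∀ p, 1 < p → ∀ r ∈ Ioo (rp p) 1, 0 < u p r
  sp_mem : ∀ p, 1 < p → sp p ∈ Ioo (rp p) 1
  sp_max : ∀ p, 1 < p → ∀ r ∈ Icc (0:ℝ) 1, u p r ≤ u p (sp p)
  least_energy : ∀ p, 1 < p → ∀ v : ℝ → ℝ,
    ContDiffOn ℝ 1 v (Icc (0:ℝ) 1) → v 1 = 0 →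
    (∃ r ∈ Ioo (0:ℝ) 1, 0 < v r) → (∃ r ∈ Ioo (0:ℝ) 1, v r < 0) →
    nehariPos p v → nehariNeg p v →
    radialEnergy p (u p) ≤ radialEnergy p v

/-- `ε_p⁺`, defined by `(ε_p⁺)⁻² = p · ‖u_p⁺‖_∞^{p−1} = p · u_p(s_p)^{p−1}`. -/
def epsP (F : LaneEmdenFamily) (p : ℝ) : ℝ :=
  1 / Real.sqrt (p * F.u p (F.sp p) ^ (p - 1))

/-- `ε_p⁻`, defined by `(ε_p⁻)⁻² = p · ‖u_p⁻‖_∞^{p−1} = p · |u_p(0)|^{p−1}`. -/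
def epsM (F : LaneEmdenFamily) (p : ℝ) : ℝ :=
  1 / Real.sqrt (p * (-F.u p 0) ^ (p - 1))

/-- `α = √(2l² + 4)`. -/
def alphaOf (l : ℝ) : ℝ := Real.sqrt (2 * l ^ 2 + 4)

/-- `β = ((α+2)/(α−2))^{1/α} · l`. -/
def betaOf (l : ℝ) : ℝ := ((alphaOf l + 2) / (alphaOf l - 2)) ^ (1 / alphaOf l) * l

/-- The singular Liouville profile `Z_l(r) = log(2α²β^α r^{α−2}/(β^α + r^α)²)`. -/
def Zl (l : ℝ) (r : ℝ) : ℝ :=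
  Real.log (2 * alphaOf l ^ 2 * betaOf l ^ alphaOf l * r ^ (alphaOf l - 2)
    / (betaOf l ^ alphaOf l + r ^ alphaOf l) ^ 2)

/-- A positive solution `u` of `-u'' - u'/r = u ^ p` on `(s, 1)` with `u'(s) = 0` and `u(1) = 0`,
written through the normalised profile `h = u / u(s)` and the mass `W = -p r h'`, where
`K = p * u(s) ^ (p - 1)`. -/
structure IsRadialProfile (p s K : ℝ) (h W : ℝ → ℝ) : Prop where
  one_lt : 1 < p
  left_pos : 0 < s
  left_lt : s < 1
  coeff_pos : 0 < K
  continuousOn_profile : ContinuousOn h (Icc s 1)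
  continuousOn_mass : ContinuousOn W (Icc s 1)
  profile_left : h s = 1
  profile_right : h 1 = 0
  mass_left : W s = 0
  profile_pos : ∀ r ∈ Ioo s 1, 0 < h r
  hasDerivAt_profile : ∀ r ∈ Ioo s 1, HasDerivAt h (-(W r) / (p * r)) r
  hasDerivAt_mass : ∀ r ∈ Ioo s 1, HasDerivAt W (K * r * h r ^ p) r

namespace IsRadialProfile

variable {p s K : ℝ} {h W : ℝ → ℝ}

lemma monotoneOn_mass (H : IsRadialProfile p s K h W) : MonotoneOn W (Icc s 1) := by
  refine monotoneOn_of_hasDerivWithinAt_nonneg (convex_Icc s 1) H.continuousOn_mass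
    (f' := fun r => K * r * h r ^ p) ?_ ?_
  · intro r hr
    rw [interior_Icc] at hr
    exact (H.hasDerivAt_mass r hr).hasDerivWithinAt
  · intro r hr
    rw [interior_Icc] at hr
    have := H.profile_pos r hr
    have := H.left_pos.trans hr.1
    have := H.coeff_pos
    positivity

lemma mass_nonneg (H : IsRadialProfile p s K h W) {r : ℝ} (hr : r ∈ Icc s 1) : 0 ≤ W r := by
  have := H.monotoneOn_mass (left_mem_Icc.2 H.left_lt.le) hr hr.1
  rwa [H.mass_left] at this

lemma mass_le (H : IsRadialProfile p s K h W) {r : ℝ} (hr : r ∈ Icc s 1) : W r ≤ W 1 :=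
  H.monotoneOn_mass hr (right_mem_Icc.2 H.left_lt.le) hr.2

/-- The Pohozaev function of a radial profile. -/
def pohozaev (p K : ℝ) (h W : ℝ → ℝ) (r : ℝ) : ℝ :=
  K * r ^ 2 * h r ^ (p + 1) + (1 + 1 / p) * W r ^ 2 / 2 - 2 * h r * W r

lemma continuousOn_pohozaev (H : IsRadialProfile p s K h W) :
    ContinuousOn (pohozaev p K h W) (Icc s 1) := by
  have hp := H.one_lt
  have h1 := H.continuousOn_profile
  have h2 := H.continuousOn_mass
  have h3 : ContinuousOn (fun r => h r ^ (p + 1)) (Icc s 1) :=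
    h1.rpow_const fun _ _ => Or.inr (by linarith)
  unfold pohozaev
  fun_prop

lemma hasDerivAt_pohozaev (H : IsRadialProfile p s K h W) {r : ℝ} (hr : r ∈ Ioo s 1) :
    HasDerivAt (pohozaev p K h W) (2 * W r ^ 2 / (p * r)) r := by
  have hp : p ≠ 0 := by linarith [H.one_lt]
  have hr0 : r ≠ 0 := (H.left_pos.trans hr.1).ne'
  have hpos := H.profile_pos r hr
  have dh := H.hasDerivAt_profile r hr
  have dW := H.hasDerivAt_mass r hr
  have dpow := dh.rpow_const (p := p + 1) (Or.inl hpos.ne')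
  rw [add_sub_cancel_right] at dpow
  have key := ((((hasDerivAt_id r).pow 2).const_mul K).mul dpow).add
    (((dW.pow 2).const_mul (1 + 1 / p)).div_const 2) |>.sub ((dh.const_mul 2).mul dW)
  refine key.congr_deriv ?_
  simp only [id, Pi.pow_apply, rpow_add hpos, rpow_one]
  field_simp
  push_cast
  ring

lemma monotoneOn_pohozaev (H : IsRadialProfile p s K h W) :
    MonotoneOn (pohozaev p K h W) (Icc s 1) := by
  refine monotoneOn_of_hasDerivWithinAt_nonneg (convex_Icc s 1) H.continuousOn_pohozaev
    (f' := fun r => 2 * W r ^ 2 / (p * r)) ?_ ?_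
  · intro r hr
    rw [interior_Icc] at hr
    exact (H.hasDerivAt_pohozaev hr).hasDerivWithinAt
  · intro r hr
    rw [interior_Icc] at hr
    have := H.left_pos.trans hr.1
    have := H.one_lt
    positivity

lemma pohozaev_left (H : IsRadialProfile p s K h W) : pohozaev p K h W s = K * s ^ 2 := by
  simp [pohozaev, H.profile_left, H.mass_left]

lemma pohozaev_right (H : IsRadialProfile p s K h W) :
    pohozaev p K h W 1 = (1 + 1 / p) * W 1 ^ 2 / 2 := by
  have : p + 1 ≠ 0 := by linarith [H.one_lt]
  simp [pohozaev, H.profile_right, zero_rpow this]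

lemma antitoneOn_pohozaev_add (H : IsRadialProfile p s K h W) :
    AntitoneOn (fun r => pohozaev p K h W r + 2 * W 1 * h r) (Icc s 1) := by
  refine antitoneOn_of_hasDerivWithinAt_nonpos (convex_Icc s 1)
    (H.continuousOn_pohozaev.add (H.continuousOn_profile.const_mul _))
    (f' := fun r => 2 * W r ^ 2 / (p * r) + 2 * W 1 * (-(W r) / (p * r))) ?_ ?_
  · intro r hr
    rw [interior_Icc] at hr
    exact ((H.hasDerivAt_pohozaev hr).add
      ((H.hasDerivAt_profile r hr).const_mul _)).hasDerivWithinAt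
  · intro r hr
    rw [interior_Icc] at hr
    have h0 := H.left_pos.trans hr.1
    have h1 := H.one_lt
    have h2 := H.mass_nonneg (Ioo_subset_Icc_self hr)
    have h3 := H.mass_le (Ioo_subset_Icc_self hr)
    have : 2 * W r ^ 2 / (p * r) + 2 * W 1 * (-(W r) / (p * r))
        = -(2 * (W r * (W 1 - W r)) / (p * r)) := by ring
    rw [this, neg_nonpos]
    have := mul_nonneg h2 (sub_nonneg.2 h3)
    positivity

lemma mass_right_le (H : IsRadialProfile p s K h W) :
    W 1 ≤ 2 + √(4 + 2 * (K * s ^ 2)) := by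
  have h1 := H.antitoneOn_pohozaev_add (left_mem_Icc.2 H.left_lt.le)
    (right_mem_Icc.2 H.left_lt.le) H.left_lt.le
  simp only [H.pohozaev_left, H.pohozaev_right, H.profile_left, H.profile_right] at h1
  have h2 : 0 ≤ 1 / p * W 1 ^ 2 := by
    have := H.one_lt
    positivity
  have h3 : W 1 - 2 ≤ √(4 + 2 * (K * s ^ 2)) := le_sqrt_of_sq_le (by nlinarith)
  linarith

lemma one_sub_profile_le (H : IsRadialProfile p s K h W) {r : ℝ} (hr : r ∈ Icc s 1) :
    1 - h r ≤ W 1 / p * (log r - log s) := by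
  have hmono : MonotoneOn (fun r => h r + W 1 / p * log r) (Icc s 1) := by
    refine monotoneOn_of_hasDerivWithinAt_nonneg (convex_Icc s 1)
      (H.continuousOn_profile.add (ContinuousOn.const_mul ?_ _))
      (f' := fun r => -(W r) / (p * r) + W 1 / p * r⁻¹) ?_ ?_
    · exact continuousOn_log.mono fun x hx => (H.left_pos.trans_le hx.1).ne'
    · intro x hx
      rw [interior_Icc] at hx
      exact ((H.hasDerivAt_profile x hx).add ((hasDerivAt_log
        (H.left_pos.trans hx.1).ne').const_mul _)).hasDerivWithinAt
    · intro x hx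
      rw [interior_Icc] at hx
      have h0 := H.left_pos.trans hx.1
      have h1 := H.one_lt
      have h3 := sub_nonneg.2 (H.mass_le (Ioo_subset_Icc_self hx))
      have : -(W x) / (p * x) + W 1 / p * x⁻¹ = (W 1 - W x) / (p * x) := by
        field_simp
        ring
      rw [this]
      positivity
  have := hmono (left_mem_Icc.2 H.left_lt.le) hr hr.1
  simp only [H.profile_left] at this
  linarith

/-- A mean value argument on the logarithmic scale finds a radius where the potential term of the
Pohozaev function is negligible. -/
lemma le_mass_right (H : IsRadialProfile p s K h W) {C : ℝ} (hC : W 1 ≤ C)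
    (hCp : C ≤ √p) (hδ : C / √p + 2 * C ^ 2 / √p + C ^ 2 / (2 * p) < K * s ^ 2) :
    2 + √(4 + 2 * (K * s ^ 2 - (C / √p + 2 * C ^ 2 / √p + C ^ 2 / (2 * p)))) ≤ W 1 := by
  have hp : 0 < p := by linarith [H.one_lt]
  have hq : 0 < √p := sqrt_pos.2 hp
  have hqq : √p * √p = p := mul_self_sqrt hp.le
  have hs := H.left_pos
  have hone : (1 : ℝ) ∈ Icc s 1 := right_mem_Icc.2 H.left_lt.le
  have hW1 : 0 ≤ W 1 := H.mass_nonneg hone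
  have hlen : √p ≤ -log s := by
    have h1 := H.one_sub_profile_le hone
    rw [H.profile_right, log_one, sub_zero, zero_sub] at h1
    have hlog : 0 ≤ -log s := by linarith [log_neg hs H.left_lt]
    have h2 : p ≤ W 1 * -log s := by
      have : W 1 / p * -log s = W 1 * -log s / p := by ring
      rwa [this, le_div_iff₀ hp, one_mul] at h1
    have h3 : √p * √p ≤ √p * -log s := by
      rw [hqq]
      exact h2.trans (mul_le_mul_of_nonneg_right (hC.trans hCp) hlog)
    exact le_of_mul_le_mul_left h3 hq
  set R := s * exp √p with hR
  have hlogR : log R = log s + √p := by rw [hR, log_mul hs.ne' (exp_ne_zero _), log_exp]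
  have hsR : s < R := by
    rw [hR]
    nlinarith [add_one_lt_exp hq.ne']
  have hR1 : R ≤ 1 := (log_nonpos_iff (hs.trans hsR).le).1 (by linarith)
  have hsub : Icc s R ⊆ Icc s 1 := Icc_subset_Icc_right hR1
  obtain ⟨r, hr, hmean⟩ := exists_ratio_hasDerivAt_eq_ratio_slope W (fun r => K * r * h r ^ p) hsR
    (H.continuousOn_mass.mono hsub)
    (fun x hx => H.hasDerivAt_mass x ⟨hx.1, hx.2.trans_le hR1⟩) log (fun r => r⁻¹)
    (continuousOn_log.mono fun x hx => (hs.trans_le hx.1).ne')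
    (fun x hx => hasDerivAt_log (hs.trans hx.1).ne')
  have hr' : r ∈ Ioo s 1 := ⟨hr.1, hr.2.trans_le hR1⟩
  have hrI := Ioo_subset_Icc_self hr'
  have hr0 : 0 < r := hs.trans hr.1
  have hh := H.profile_pos r hr'
  have hWr := H.mass_nonneg hrI
  have hWr1 := H.mass_le hrI
  have hpot : K * r ^ 2 * h r ^ p ≤ C / √p := by
    rw [hlogR, H.mass_left] at hmean
    have h1 : W R = K * r ^ 2 * h r ^ p * √p := by
      field_simp at hmean
      linarith
    rw [le_div_iff₀ hq, ← h1]
    exact (H.mass_le (hsub (right_mem_Icc.2 hsR.le))).trans hC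
  have hle1 : h r ≤ 1 := by
    have hanti : AntitoneOn h (Icc s 1) := by
      refine antitoneOn_of_hasDerivWithinAt_nonpos (convex_Icc s 1) H.continuousOn_profile
        (f' := fun r => -(W r) / (p * r)) ?_ ?_
      · intro x hx
        rw [interior_Icc] at hx
        exact (H.hasDerivAt_profile x hx).hasDerivWithinAt
      · intro x hx
        rw [interior_Icc] at hx
        have := H.mass_nonneg (Ioo_subset_Icc_self hx)
        have := hs.trans hx.1
        rw [neg_div, neg_nonpos]
        positivity
    exact H.profile_left ▸ hanti (left_mem_Icc.2 H.left_lt.le) hrI hrI.1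
  have hdef : 1 - h r ≤ C / √p := by
    have h1 : log r - log s ≤ √p := by linarith [log_le_log hr0 hr.2.le]
    calc 1 - h r ≤ W 1 / p * (log r - log s) := H.one_sub_profile_le hrI
      _ ≤ C / p * √p := by
        have := hW1.trans hC
        exact mul_le_mul (by gcongr) h1 (by linarith [log_le_log hs hr.1.le]) (by positivity)
      _ = C / √p := by
        field_simp
        nlinarith
  have hpoh := H.monotoneOn_pohozaev (left_mem_Icc.2 H.left_lt.le) hrI hrI.1
  rw [H.pohozaev_left, pohozaev, rpow_add hh, rpow_one] at hpoh
  have e1 : K * r ^ 2 * (h r ^ p * h r) ≤ C / √p := by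
    have : 0 ≤ K * r ^ 2 * h r ^ p := by
      have := H.coeff_pos
      positivity
    nlinarith
  have e2 : 2 * (1 - h r) * W r ≤ 2 * C ^ 2 / √p := by
    have : (1 - h r) * W r ≤ C / √p * C :=
      mul_le_mul hdef (hWr1.trans hC) hWr (by linarith)
    calc 2 * (1 - h r) * W r ≤ 2 * (C / √p * C) := by linarith
      _ = _ := by ring
  have e3 : 1 / p * W r ^ 2 / 2 ≤ C ^ 2 / (2 * p) := by
    calc 1 / p * W r ^ 2 / 2 = W r ^ 2 / (2 * p) := by field_simp
      _ ≤ _ := by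
        gcongr
        exact hWr1.trans hC
  set δ := C / √p + 2 * C ^ 2 / √p + C ^ 2 / (2 * p)
  have hsq : 4 + 2 * (K * s ^ 2 - δ) ≤ (W r - 2) ^ 2 := by nlinarith
  have hroot : √(4 + 2 * (K * s ^ 2 - δ)) ≤ |W r - 2| := by
    rw [← sqrt_sq_eq_abs]
    exact sqrt_le_sqrt hsq
  have h2W : 2 ≤ W r := by nlinarith
  rw [abs_of_nonneg (by linarith)] at hroot
  linarith

end IsRadialProfile

/-- If the Pohozaev boundary term `K s ^ 2` converges to `L > 0` while `p → ∞`, the total mass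
converges to the larger root of `x ^ 2 / 2 - 2 * x = L`. -/
theorem tendsto_mass_right {p s K : ℕ → ℝ} {h W : ℕ → ℝ → ℝ} {L : ℝ}
    (H : ∀ n, IsRadialProfile (p n) (s n) (K n) (h n) (W n)) (hp : Tendsto p atTop atTop)
    (hL : 0 < L) (hlim : Tendsto (fun n => K n * s n ^ 2) atTop (nhds L)) :
    Tendsto (fun n => W n 1) atTop (nhds (2 + √(4 + 2 * L))) := by
  set C : ℕ → ℝ := fun n => 2 + √(4 + 2 * (K n * s n ^ 2)) with hC
  set δ : ℕ → ℝ := fun n => C n / √(p n) + 2 * C n ^ 2 / √(p n) + C n ^ 2 / (2 * p n) with hδ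
  have hCt : Tendsto C atTop (nhds (2 + √(4 + 2 * L))) :=
    ((hlim.const_mul 2).const_add 4).sqrt.const_add 2
  have hq : Tendsto (fun n => √(p n)) atTop atTop := tendsto_sqrt_atTop.comp hp
  have hδt : Tendsto δ atTop (nhds 0) := by
    have h1 := hCt.div_atTop hq
    have h2 := ((hCt.pow 2).const_mul 2).div_atTop hq
    have h3 := (hCt.pow 2).div_atTop (hp.const_mul_atTop (two_pos : (0 : ℝ) < 2))
    simpa using (h1.add h2).add h3
  have hlow : Tendsto (fun n => 2 + √(4 + 2 * (K n * s n ^ 2 - δ n))) atTop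
      (nhds (2 + √(4 + 2 * L))) := by
    have h1 : Tendsto (fun n => K n * s n ^ 2 - δ n) atTop (nhds L) := by
      simpa using hlim.sub hδt
    exact ((h1.const_mul 2).const_add 4).sqrt.const_add 2
  refine tendsto_of_tendsto_of_tendsto_of_le_of_le' hlow hCt ?_
    (Eventually.of_forall fun n => (H n).mass_right_le)
  have hCq : ∀ᶠ n in atTop, C n ≤ √(p n) := by
    filter_upwards [hCt.eventually_le_const (lt_add_one _),
      hq.eventually_ge_atTop (2 + √(4 + 2 * L) + 1)] with n h1 h2 using h1.trans h2
  filter_upwards [hCq, hδt.eventually_lt hlim hL] with n h1 h2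
  exact (H n).le_mass_right (H n).mass_right_le h1 h2

namespace LaneEmdenFamily

variable (F : LaneEmdenFamily) {p : ℝ}

/-- The radial derivative of `u p`, one-sided at the endpoints. -/
def radialDeriv (p : ℝ) : ℝ → ℝ := derivWithin (F.u p) (Icc 0 1)

lemma continuousOn_radialDeriv (hp : 1 < p) : ContinuousOn (F.radialDeriv p) (Icc 0 1) :=
  (F.smooth p hp).continuousOn_derivWithin (uniqueDiffOn_Icc zero_lt_one) (by norm_num)

lemma hasDerivAt_u (hp : 1 < p) {r : ℝ} (hr : r ∈ Ioo (0 : ℝ) 1) :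
    HasDerivAt (F.u p) (F.radialDeriv p r) r :=
  (((F.smooth p hp).differentiableOn (by norm_num)) r
    (Ioo_subset_Icc_self hr)).hasDerivWithinAt.hasDerivAt (Icc_mem_nhds hr.1 hr.2)

lemma hasDerivAt_radialDeriv (hp : 1 < p) {r : ℝ} (hr : r ∈ Ioo (0 : ℝ) 1) :
    HasDerivAt (F.radialDeriv p)
      (-(|F.u p r| ^ (p - 1) * F.u p r) - F.radialDeriv p r / r) r := by
  have heq : F.radialDeriv p =ᶠ[nhds r] deriv (F.u p) := by
    filter_upwards [Ioo_mem_nhds hr.1 hr.2] with x hx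
    exact (F.hasDerivAt_u hp hx).deriv.symm
  have hdiff : DifferentiableAt ℝ (F.radialDeriv p) r := by
    have h1 : ContDiffOn ℝ 1 (F.radialDeriv p) (Icc 0 1) :=
      (F.smooth p hp).derivWithin (uniqueDiffOn_Icc zero_lt_one) (by norm_num)
    exact (h1.differentiableOn (by norm_num)).differentiableAt (Icc_mem_nhds hr.1 hr.2)
  refine hdiff.hasDerivAt.congr_deriv ?_
  rw [heq.deriv_eq, heq.eq_of_nhds]
  linarith [F.ode p hp r hr]

lemma sp_mem_Ioo (hp : 1 < p) : F.sp p ∈ Ioo (0 : ℝ) 1 :=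
  ⟨(F.rp_mem p hp).1.trans (F.sp_mem p hp).1, (F.sp_mem p hp).2⟩

lemma u_sp_pos (hp : 1 < p) : 0 < F.u p (F.sp p) := F.pos_out p hp _ (F.sp_mem p hp)

lemma radialDeriv_sp (hp : 1 < p) : F.radialDeriv p (F.sp p) = 0 := by
  have hs := F.sp_mem_Ioo hp
  refine IsLocalMax.hasDerivAt_eq_zero ?_ (F.hasDerivAt_u hp hs)
  filter_upwards [Icc_mem_nhds hs.1 hs.2] with x hx using F.sp_max p hp x hx

/-- The mass function `-(p / u(s_p)) * r * u'(r)`. -/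
def mass (p r : ℝ) : ℝ :=
  -(p / F.u p (F.sp p)) * (r * F.radialDeriv p r)

lemma continuousOn_mass (hp : 1 < p) : ContinuousOn (F.mass p) (Icc (F.sp p) 1) :=
  ((continuousOn_id.mul (F.continuousOn_radialDeriv hp)).const_mul _).mono
    (Icc_subset_Icc_left (F.sp_mem_Ioo hp).1.le)

lemma mass_sp (hp : 1 < p) : F.mass p (F.sp p) = 0 := by
  simp [mass, F.radialDeriv_sp hp]

lemma hasDerivAt_mass (hp : 1 < p) {r : ℝ} (hr : r ∈ Ioo (F.sp p) 1) :
    HasDerivAt (F.mass p) (p / F.u p (F.sp p) * (r * F.u p r ^ p)) r := by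
  have hr0 : 0 < r := (F.sp_mem_Ioo hp).1.trans hr.1
  have hu : 0 < F.u p r := F.pos_out p hp r ⟨(F.sp_mem p hp).1.trans hr.1, hr.2⟩
  have key := ((hasDerivAt_id r).mul
    (F.hasDerivAt_radialDeriv hp ⟨hr0, hr.2⟩)).const_mul (-(p / F.u p (F.sp p)))
  refine key.congr_deriv ?_
  rw [abs_of_pos hu, rpow_sub_one hu.ne', div_mul_cancel₀ _ hu.ne', id]
  field_simp
  ring

lemma isRadialProfile (hp : 1 < p) :
    IsRadialProfile p (F.sp p) (p * F.u p (F.sp p) ^ (p - 1))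
      (fun r => F.u p r / F.u p (F.sp p)) (F.mass p) where
  one_lt := hp
  left_pos := (F.sp_mem_Ioo hp).1
  left_lt := (F.sp_mem_Ioo hp).2
  coeff_pos := by
    have := F.u_sp_pos hp
    positivity
  continuousOn_profile := ((F.smooth p hp).continuousOn.div_const _).mono
    (Icc_subset_Icc_left (F.sp_mem_Ioo hp).1.le)
  continuousOn_mass := F.continuousOn_mass hp
  profile_left := div_self (F.u_sp_pos hp).ne'
  profile_right := by simp [F.boundary p hp]
  mass_left := F.mass_sp hp
  profile_pos r hr :=
    div_pos (F.pos_out p hp r ⟨(F.sp_mem p hp).1.trans hr.1, hr.2⟩) (F.u_sp_pos hp)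
  hasDerivAt_profile r hr := by
    have hr0 : 0 < r := (F.sp_mem_Ioo hp).1.trans hr.1
    refine ((F.hasDerivAt_u hp ⟨hr0, hr.2⟩).div_const _).congr_deriv ?_
    have := F.u_sp_pos hp
    rw [mass]
    field_simp
  hasDerivAt_mass r hr := by
    have hM := F.u_sp_pos hp
    have hu : 0 < F.u p r := F.pos_out p hp r ⟨(F.sp_mem p hp).1.trans hr.1, hr.2⟩
    refine (F.hasDerivAt_mass hp hr).congr_deriv ?_
    rw [div_rpow hu.le hM.le, rpow_sub_one hM.ne']
    field_simp

lemma integral_eq_mass (hp : 1 < p) :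
    p / F.u p (F.sp p) * ∫ s in (F.sp p)..1, s * F.u p s ^ p = F.mass p 1 := by
  have hs := F.sp_mem_Ioo hp
  have hcont : ContinuousOn (fun s => p / F.u p (F.sp p) * (s * F.u p s ^ p))
      (Icc (F.sp p) 1) := by
    have h1 : ContinuousOn (F.u p) (Icc (F.sp p) 1) :=
      (F.smooth p hp).continuousOn.mono (Icc_subset_Icc_left hs.1.le)
    exact (continuousOn_id.mul
      (h1.rpow_const fun _ _ => Or.inr (zero_le_one.trans hp.le))).const_mul _
  rw [← intervalIntegral.integral_const_mul,
    intervalIntegral.integral_eq_sub_of_hasDerivAt_of_le hs.2.le (F.continuousOn_mass hp)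
      (fun r hr => F.hasDerivAt_mass hp hr) (hcont.intervalIntegrable_of_Icc hs.2.le),
    F.mass_sp hp, sub_zero]

lemma sq_sp_div_epsP (hp : 1 < p) :
    (F.sp p / epsP F p) ^ 2 = p * F.u p (F.sp p) ^ (p - 1) * F.sp p ^ 2 := by
  have hM := F.u_sp_pos hp
  have hK : 0 ≤ p * F.u p (F.sp p) ^ (p - 1) := by positivity
  rw [epsP, div_div_eq_mul_div, div_one, mul_pow, sq_sqrt hK, mul_comm]

end LaneEmdenFamily


/-- Under the stated limit assumptions, `I_p = (p/u_p(s_p))·∫_{s_p}^1 s·u_p(s)^p ds` converges to `α + 2` (in particular it is bounded). -/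
theorem Ip_tendsto (F : LaneEmdenFamily) (pn : ℕ → ℝ) (hpn : ∀ n, 1 < pn n)
    (hto : Tendsto pn atTop atTop) (l rinf uinf : ℝ)
    (hl : 0 < l) (hrinf : 0 < rinf) (hrinf1 : rinf ≤ 1) (huinf : 0 < uinf)
    (hlimL : Tendsto (fun n => F.sp (pn n) / epsP F (pn n)) atTop (nhds l))
    (hlimR : Tendsto (fun n => F.rp (pn n) ^ (2 / (pn n - 1))) atTop (nhds rinf))
    (hlimU : Tendsto (fun n => F.u (pn n) (F.sp (pn n))) atTop (nhds uinf)) :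
    Tendsto (fun n => (pn n / F.u (pn n) (F.sp (pn n))) *
      ∫ s in (F.sp (pn n))..1, s * F.u (pn n) s ^ (pn n)) atTop
    (nhds (alphaOf l + 2)) := by
  have hlim : Tendsto (fun n => pn n * F.u (pn n) (F.sp (pn n)) ^ (pn n - 1) * F.sp (pn n) ^ 2)
      atTop (nhds (l ^ 2)) :=
    (hlimL.pow 2).congr fun n => F.sq_sp_div_epsP (hpn n)
  have key := tendsto_mass_right (fun n => F.isRadialProfile (hpn n)) hto (by positivity) hlim
  have hα : alphaOf l + 2 = 2 + √(4 + 2 * l ^ 2) := by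
    rw [alphaOf, add_comm, add_comm (2 * l ^ 2)]
  rw [hα]
  exact key.congr fun n => (F.integral_eq_mass (hpn n)).symm
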